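/- arXiv:1711.00388 — 2 statements merged into one kernel-verified Lean document; each statement's English description precedes it below -/
import Mathlib

section
/- There exists an absolute constant C > 0 such that the following holds. Let m ≥ 1, let D be a semi-uniform probability measure on the disjoint union X of measurable spaces X_1,…,X_m with composition classes P and P^t as in the composition setup, let λ > 0, let ε, μ ∈ (0,1), let α ∈ [0,1], and set t = 4λ/ε. Let l be an integer with C·(1/(ε·μ²) + 1/ε²) ≤ l ≤ m, let I be a uniformly random size-l subset of {1,…,m}, and let D_I denote D conditioned on the event that the point lies in ∪_{i∈I} X_i. If f is measurable and f ∈ P_D(λ·m, α), then with probability at least 5/6 over the choice of I there exists g ∈ P^t((1+μ/2)·λ·l) with dist_{D_I}(f,g) ≤ α + ε/2. -/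
open MeasureTheory ProbabilityTheory
open scoped Classical

/-- Distance between two Boolean functions with respect to a measure `D`:
the measure of the set where they disagree. -/
noncomputable def distD {α : Type*} [MeasurableSpace α] (D : Measure α) (f g : α → Bool) : ℝ :=
  (D {x | f x ≠ g x}).toReal

/-- The composition class `P(d)` of the additive properties `C i k`. -/
def compClass {m : ℕ} {X : Fin m → Type*} [∀ i, MeasurableSpace (X i)]
    (C : (i : Fin m) → ℕ → Set (X i → Bool)) (d : ℝ) : Set ((Σ i, X i) → Bool) :=
  {f | Measurable f ∧ ∃ k : Fin m → ℕ,
    (∑ i, (k i : ℝ)) ≤ d ∧ ∀ i, (fun x => f ⟨i, x⟩) ∈ C i (k i)}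

/-- The truncated composition class `P^t(d)`. -/
def compClassT {m : ℕ} {X : Fin m → Type*} [∀ i, MeasurableSpace (X i)]
    (C : (i : Fin m) → ℕ → Set (X i → Bool)) (t d : ℝ) : Set ((Σ i, X i) → Bool) :=
  {f | Measurable f ∧ ∃ k : Fin m → ℕ,
    (∑ i, (k i : ℝ)) ≤ d ∧ (∀ i, (k i : ℝ) ≤ t) ∧ ∀ i, (fun x => f ⟨i, x⟩) ∈ C i (k i)}

/-- `P_D(d, α)`: measurable functions `α`-close to `P(d)` w.r.t. `D`. -/
noncomputable def compClose {m : ℕ} {X : Fin m → Type*} [∀ i, MeasurableSpace (X i)]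
    (C : (i : Fin m) → ℕ → Set (X i → Bool)) (D : Measure (Σ i, X i)) (d α : ℝ) :
    Set ((Σ i, X i) → Bool) :=
  {f | Measurable f ∧ ∃ g ∈ compClass C d, distD D f g ≤ α}

/-- Second moment of the sum of a centred function over a uniformly random `l`-element subset. -/
theorem sum_powersetCard_sq_le {ι : Type*} [Fintype ι] (l : ℕ) (hl : 0 < l)
    (b : ι → ℝ) (hb : ∑ i, b i = 0) :
    (Fintype.card ι : ℝ) * ∑ s ∈ Finset.univ.powersetCard l, (∑ i ∈ s, b i) ^ 2 ≤
      l * (Fintype.card ι).choose l * ∑ i, b i ^ 2 := by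
  obtain ⟨N, hN⟩ : ∃ N : ℕ, ∀ i j : ι, i ≠ j →
      ((Finset.univ.powersetCard l).filter (fun s => i ∈ s ∧ j ∈ s)).card = N := by
    rcases lt_or_ge l 2 with hl2 | hl2
    · refine ⟨0, fun i j hij => ?_⟩
      rw [Finset.card_eq_zero, Finset.filter_eq_empty_iff]
      rintro s hs ⟨hi, hj⟩
      rw [Finset.mem_powersetCard_univ] at hs
      have := Finset.one_lt_card.mpr ⟨i, hi, j, hj, hij⟩
      omega
    · refine ⟨(Fintype.card ι - 2).choose (l - 2), fun i j hij => ?_⟩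
      have := Finset.card_filter_powersetCard_subset {i, j} _ l (Finset.subset_univ _)
        (by rwa [Finset.card_pair hij])
      rw [Finset.card_pair hij, Finset.card_univ] at this
      rw [← this]
      congr 1
      ext s
      simp [Finset.insert_subset_iff]
  set N₁ : ℕ := (Fintype.card ι - 1).choose (l - 1) with hN₁
  have hdiag : ∀ i : ι, ((Finset.univ.powersetCard l).filter (fun s => i ∈ s)).card = N₁ := by
    intro i
    have := Finset.card_filter_powersetCard_subset {i} _ l (Finset.subset_univ _)
      (by rwa [Finset.card_singleton])
    rw [Finset.card_singleton, Finset.card_univ] at this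
    rw [hN₁, ← this]
    congr 1
    ext s
    simp
  have hexp : ∑ s ∈ Finset.univ.powersetCard l, (∑ i ∈ s, b i) ^ 2 =
      ∑ i, ∑ j, b i * b j *
        ((Finset.univ.powersetCard l).filter (fun s => i ∈ s ∧ j ∈ s)).card := by
    have h1 : ∀ s : Finset ι, (∑ i ∈ s, b i) ^ 2 =
        ∑ i, ∑ j, if i ∈ s ∧ j ∈ s then b i * b j else 0 := by
      intro s
      have : ∑ i ∈ s, b i = ∑ i, if i ∈ s then b i else 0 := by simp
      rw [this, sq, Finset.sum_mul_sum]
      refine Finset.sum_congr rfl fun i _ => Finset.sum_congr rfl fun j _ => ?_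
      by_cases hi : i ∈ s <;> by_cases hj : j ∈ s <;> simp [hi, hj]
    simp_rw [h1]
    rw [Finset.sum_comm]
    refine Finset.sum_congr rfl fun i _ => ?_
    rw [Finset.sum_comm]
    refine Finset.sum_congr rfl fun j _ => ?_
    rw [← Finset.sum_filter, Finset.sum_const, nsmul_eq_mul, mul_comm]
  have hval : ∑ s ∈ Finset.univ.powersetCard l, (∑ i ∈ s, b i) ^ 2 =
      ((N₁ : ℝ) - N) * ∑ i, b i ^ 2 := by
    have h2 : ∀ i j : ι, b i * b j *
        ((Finset.univ.powersetCard l).filter (fun s => i ∈ s ∧ j ∈ s)).card =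
        b i * b j * N + if i = j then ((N₁ : ℝ) - N) * b i ^ 2 else 0 := by
      intro i j
      split_ifs with hij
      · subst hij
        simp only [and_self, hdiag]
        ring
      · rw [hN i j hij, add_zero]
    rw [hexp]
    simp_rw [h2, Finset.sum_add_distrib, ← Finset.sum_mul, ← Finset.mul_sum, hb]
    simp [Finset.mul_sum]
  have hchoose : (Fintype.card ι : ℝ) * N₁ ≤ l * (Fintype.card ι).choose l := by
    rcases Nat.eq_zero_or_pos (Fintype.card ι) with h0 | h0
    · rw [h0]; simp; positivity
    · obtain ⟨n, hn⟩ := Nat.exists_eq_add_of_lt h0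
      obtain ⟨k, rfl⟩ := Nat.exists_eq_add_of_lt hl
      have := Nat.add_one_mul_choose_eq n k
      rw [hN₁, hn]
      simp only [zero_add, Nat.add_sub_cancel]
      refine le_of_eq ?_
      rw [mul_comm ((k + 1 : ℕ) : ℝ)]
      exact_mod_cast this
  have hS : 0 ≤ ∑ i, b i ^ 2 := Finset.sum_nonneg fun i _ => sq_nonneg _
  rw [hval]
  have : (Fintype.card ι : ℝ) * ((N₁ : ℝ) - N) ≤ l * (Fintype.card ι).choose l := by
    have : (0 : ℝ) ≤ Fintype.card ι * N := by positivity
    linarith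
  calc _ = (Fintype.card ι : ℝ) * ((N₁ : ℝ) - N) * ∑ i, b i ^ 2 := by ring
    _ ≤ _ := mul_le_mul_of_nonneg_right this hS

/-- Chebyshev's inequality for sampling without replacement. -/
theorem card_filter_powersetCard_sum_gt_le {ι : Type*} [Fintype ι] [Nonempty ι] (l : ℕ)
    (hl : 0 < l) (a : ι → ℝ) {B M δ : ℝ} (hB : 0 ≤ B) (hδ : 0 < δ)
    (ha : ∀ i, a i ∈ Set.Icc 0 B) (hM : ∑ i, a i ≤ M * Fintype.card ι) :
    (((Finset.univ.powersetCard l).filter (fun s => (M + δ) * l < ∑ i ∈ s, a i)).card : ℝ) *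
      (δ ^ 2 * l) ≤ B * M * (Fintype.card ι).choose l := by
  set n : ℝ := (Fintype.card ι : ℝ) with hn
  have hn0 : 0 < n := by rw [hn]; exact_mod_cast Fintype.card_pos
  have hl0 : (0 : ℝ) < l := by exact_mod_cast hl
  set A : ℝ := (∑ i, a i) / n with hA
  have hsum : ∑ i, a i = A * n := by rw [hA]; field_simp
  have hAM : A ≤ M := by rw [hA, div_le_iff₀ hn0]; exact hM
  have hb : ∑ i, (a i - A) = 0 := by
    rw [Finset.sum_sub_distrib, hsum]
    simp [← hn]
    ring
  have hsq : ∑ i, (a i - A) ^ 2 ≤ B * M * n := by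
    have h1 : ∑ i, (a i - A) ^ 2 = ∑ i, a i ^ 2 - n * A ^ 2 := by
      have : ∀ i, (a i - A) ^ 2 = a i ^ 2 - 2 * A * a i + A ^ 2 := fun i => by ring
      simp_rw [this, Finset.sum_add_distrib, Finset.sum_sub_distrib, ← Finset.mul_sum, hsum]
      simp [← hn]
      ring
    have h2 : ∑ i, a i ^ 2 ≤ B * ∑ i, a i := by
      rw [Finset.mul_sum]
      refine Finset.sum_le_sum fun i _ => ?_
      rw [sq]
      exact mul_le_mul_of_nonneg_right (ha i).2 (ha i).1
    have h3 : B * ∑ i, a i ≤ B * (M * n) := mul_le_mul_of_nonneg_left hM hB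
    have h4 : 0 ≤ n * A ^ 2 := by positivity
    linarith
  have hmoment := sum_powersetCard_sq_le l hl (fun i => a i - A) hb
  set bad := (Finset.univ.powersetCard l).filter (fun s => (M + δ) * l < ∑ i ∈ s, a i)
  have hlow : (bad.card : ℝ) * (δ * l) ^ 2 ≤
      ∑ s ∈ Finset.univ.powersetCard l, (∑ i ∈ s, (a i - A)) ^ 2 := by
    rw [← nsmul_eq_mul, ← Finset.sum_const]
    refine (Finset.sum_le_sum fun s hs => ?_).trans
      (Finset.sum_le_sum_of_subset_of_nonneg (Finset.filter_subset _ _)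
        fun s _ _ => sq_nonneg _)
    rw [Finset.mem_filter, Finset.mem_powersetCard_univ] at hs
    refine pow_le_pow_left₀ (by positivity) ?_ 2
    rw [Finset.sum_sub_distrib, Finset.sum_const, nsmul_eq_mul, hs.1]
    have := mul_le_mul_of_nonneg_right hAM hl0.le
    linarith [hs.2]
  have hfin : n * l * ((bad.card : ℝ) * (δ ^ 2 * l)) ≤
      n * l * (B * M * (Fintype.card ι).choose l) := by
    calc _ = n * ((bad.card : ℝ) * (δ * l) ^ 2) := by ring
      _ ≤ _ := mul_le_mul_of_nonneg_left hlow hn0.le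
      _ ≤ _ := hmoment
      _ ≤ l * (Fintype.card ι).choose l * (B * M * n) :=
        mul_le_mul_of_nonneg_left hsq (by positivity)
      _ = _ := by ring
  exact le_of_mul_le_mul_left hfin (by positivity)
theorem measurableSet_sigma_fst_mem {ι : Type*} {X : ι → Type*} [∀ i, MeasurableSpace (X i)]
    (s : Set ι) : MeasurableSet {x : Σ i, X i | x.1 ∈ s} := by
  refine MeasurableSpace.measurableSet_iInf.mpr fun i => ?_
  change MeasurableSet ((Sigma.mk i) ⁻¹' {x : Σ i, X i | x.1 ∈ s})
  exact MeasurableSet.const (i ∈ s)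

theorem measurable_sigma_of_comp_mk {ι β : Type*} {X : ι → Type*} [∀ i, MeasurableSpace (X i)]
    [MeasurableSpace β] {h : (Σ i, X i) → β} (hh : ∀ i, Measurable fun x => h ⟨i, x⟩) :
    Measurable h := fun _ ht =>
  MeasurableSpace.measurableSet_iInf.mpr fun i => hh i ht

/-- The measure of a set, restricted to finitely many pieces, is the sum over the pieces. -/
theorem sum_measureReal_sigma_fst_eq_inter {ι : Type*} {X : ι → Type*}
    [∀ i, MeasurableSpace (X i)] (D : Measure (Σ i, X i)) [IsFiniteMeasure D]
    (s : Finset ι) (E : Set (Σ i, X i)) :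
    ∑ i ∈ s, D.real ({x | x.1 = i} ∩ E) = D.real ({x | x.1 ∈ s} ∩ E) := by
  have hm : ∀ t : Set ι, MeasurableSet {x : Σ i, X i | x.1 ∈ t} := measurableSet_sigma_fst_mem
  have h := sum_measure_preimage_singleton (μ := D.restrict E) s
    (f := fun x : Σ i, X i => x.1) (fun i _ => hm {i})
  have h1 : ∀ i, D.restrict E ((fun x : Σ i, X i => x.1) ⁻¹' {i}) = D ({x | x.1 = i} ∩ E) :=
    fun i => Measure.restrict_apply (hm {i})
  have h2 : D.restrict E ((fun x : Σ i, X i => x.1) ⁻¹' ↑s) = D ({x | x.1 ∈ s} ∩ E) :=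
    Measure.restrict_apply (hm s)
  rw [h2] at h
  simp_rw [h1] at h
  rw [measureReal_def, ← h, ENNReal.toReal_sum fun _ _ => measure_ne_top _ _]
  rfl

/-- Under semi-uniformity, the conditional distance is the average of the distances on
the selected pieces. -/
theorem distD_cond_eq {m : ℕ} {X : Fin m → Type*} [∀ i, MeasurableSpace (X i)]
    (D : Measure (Σ i, X i)) [IsProbabilityMeasure D]
    (hD : ∀ i : Fin m, D {x : Σ i, X i | x.1 = i} = 1 / m)
    (s : Finset (Fin m)) (f h : (Σ i, X i) → Bool) :
    distD (D[|{x : Σ i, X i | x.1 ∈ s}]) f h =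
      (∑ i ∈ s, m * D.real ({x | x.1 = i} ∩ {x | f x ≠ h x})) / s.card := by
  have hS := sum_measureReal_sigma_fst_eq_inter D s Set.univ
  simp only [Set.inter_univ, measureReal_def, hD] at hS
  have hms : MeasurableSet {x : Σ i, X i | x.1 ∈ s} := measurableSet_sigma_fst_mem (s : Set (Fin m))
  rw [distD, cond_apply hms, ENNReal.toReal_mul,
    ENNReal.toReal_inv, ← Finset.mul_sum, sum_measureReal_sigma_fst_eq_inter, measureReal_def]
  rw [← hS]
  simp only [one_div, ENNReal.toReal_inv, ENNReal.toReal_natCast, Finset.sum_const, nsmul_eq_mul,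
    mul_inv, inv_inv]
  ring

/-- Lemma 4.1 of the paper: if `f ∈ P_D(λm, α)` then, with probability at least `5/6` over a
uniformly random size-`l` subset `I` of the `m` pieces, `f` is `(α + ε/2)`-close to
`P^t((1+μ/2)λl)` with respect to `D` conditioned on `∪_{i ∈ I} X_i`, where `t = 4λ/ε`. -/
theorem composition_in :
    ∃ c : ℝ, 0 < c ∧
      ∀ (m : ℕ) (X : Fin m → Type) [∀ i, MeasurableSpace (X i)]
        (D : Measure (Σ i, X i)) [IsProbabilityMeasure D],
        (∀ i : Fin m, D {x : Σ i, X i | x.1 = i} = 1 / m) →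
        ∀ (C : (i : Fin m) → ℕ → Set (X i → Bool)),
          (∀ i, (C i 0).Nonempty) →
          (∀ i k, ∀ g ∈ C i k, Measurable g) →
          ∀ (lam ε μ α : ℝ), 0 < lam → ε ∈ Set.Ioo (0 : ℝ) 1 → μ ∈ Set.Ioo (0 : ℝ) 1 →
            α ∈ Set.Icc (0 : ℝ) 1 →
          ∀ (l : ℕ), c * (1 / (ε * μ ^ 2) + 1 / ε ^ 2) ≤ l → l ≤ m →
          ∀ (f : (Σ i, X i) → Bool), f ∈ compClose C D (lam * m) α →
            (5 : ℝ) / 6 * ((Finset.univ : Finset (Fin m)).powersetCard l).card ≤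
              (((Finset.univ : Finset (Fin m)).powersetCard l).filter
                (fun s => ∃ g ∈ compClassT C (4 * lam / ε) ((1 + μ / 2) * lam * l),
                  distD (D[|{x : Σ i, X i | x.1 ∈ s}]) f g ≤ α + ε / 2)).card := by
  refine ⟨400, by norm_num, ?_⟩
  intro m X _ D _ hD C hC0 hCm lam ε μ α hlam hε hμ hα l hl hlm f hf
  obtain ⟨hfm, g, ⟨hgm, k, hk, hgk⟩, hfg⟩ := hf
  obtain ⟨hε0, hε1⟩ := hε
  obtain ⟨hμ0, hμ1⟩ := hμ
  have hlR : (0 : ℝ) < l := lt_of_lt_of_le (by positivity) hl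
  have hl0 : 0 < l := by exact_mod_cast hlR
  have hm0 : 0 < m := hl0.trans_le hlm
  have hmR : (0 : ℝ) < m := by exact_mod_cast hm0
  have : Nonempty (Fin m) := ⟨⟨0, hm0⟩⟩
  set t : ℝ := 4 * lam / ε with ht
  have ht0 : 0 < t := by positivity
  choose z hz using hC0
  -- replace `g` by a property of complexity `0` on the pieces of complexity exceeding `t`
  set k' : Fin m → ℕ := fun i => if (k i : ℝ) ≤ t then k i else 0 with hk'
  set h : (Σ i, X i) → Bool := fun x => if (k x.1 : ℝ) ≤ t then g x else z x.1 x.2 with hh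
  have hhC : ∀ i, (fun x => h ⟨i, x⟩) ∈ C i (k' i) := by
    intro i
    by_cases hi : (k i : ℝ) ≤ t
    · simpa [hh, hk', hi] using hgk i
    · simpa [hh, hk', hi] using hz i
  have hhm : Measurable h := measurable_sigma_of_comp_mk fun i => hCm i _ _ (hhC i)
  have hk't : ∀ i, (k' i : ℝ) ≤ t := by
    intro i
    by_cases hi : (k i : ℝ) ≤ t <;> simp [hk', hi, ht0.le]
  have hk'k : ∀ i, (k' i : ℝ) ≤ k i := by
    intro i
    by_cases hi : (k i : ℝ) ≤ t <;> simp [hk', hi]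
  set a : Fin m → ℝ := fun i => m * D.real ({x | x.1 = i} ∩ {x | f x ≠ h x}) with ha
  have ha1 : ∀ E : Set (Σ i, X i), ∀ i, m * D.real ({x | x.1 = i} ∩ E) ≤ 1 := by
    intro E i
    have h1 : D.real ({x | x.1 = i} ∩ E) ≤ D.real {x : Σ i, X i | x.1 = i} :=
      measureReal_mono Set.inter_subset_left
    have h2 : D.real {x : Σ i, X i | x.1 = i} = 1 / m := by
      rw [measureReal_def, hD]
      simp
    rw [h2, le_div_iff₀ hmR] at h1
    linarith
  have hasum : ∑ i, a i ≤ (α + ε / 4) * m := by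
    have hpt : ∀ i, a i ≤ m * D.real ({x | x.1 = i} ∩ {x | f x ≠ g x}) + k i / t := by
      intro i
      by_cases hi : (k i : ℝ) ≤ t
      · have : ({x | x.1 = i} ∩ {x | f x ≠ h x}) =
            ({x : Σ i, X i | x.1 = i} ∩ {x | f x ≠ g x}) := by
          ext ⟨j, x⟩
          simp only [Set.mem_inter_iff, Set.mem_ofPred_eq, and_congr_right_iff]
          rintro rfl
          simp [hh, hi]
        simp only [ha, this, le_add_iff_nonneg_right]
        positivity
      · have h1 : 1 ≤ k i / t := by
          rw [le_div_iff₀ ht0]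
          linarith
        have h2 : 0 ≤ m * D.real ({x | x.1 = i} ∩ {x | f x ≠ g x}) := by positivity
        linarith [ha1 {x | f x ≠ h x} i]
    have hg : ∑ i, D.real ({x : Σ i, X i | x.1 = i} ∩ {x | f x ≠ g x}) ≤ α := by
      rw [sum_measureReal_sigma_fst_eq_inter]
      simpa [distD, measureReal_def] using hfg
    calc ∑ i, a i ≤ ∑ i, (m * D.real ({x | x.1 = i} ∩ {x | f x ≠ g x}) + k i / t) :=
          Finset.sum_le_sum fun i _ => hpt i
      _ = m * ∑ i, D.real ({x | x.1 = i} ∩ {x | f x ≠ g x}) + (∑ i, (k i : ℝ)) / t := by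
          rw [Finset.sum_add_distrib, Finset.mul_sum, Finset.sum_div]
      _ ≤ m * α + lam * m / t := by gcongr
      _ = _ := by
          rw [ht]
          field_simp
  have hB1 := card_filter_powersetCard_sum_gt_le l hl0 (fun i => (k' i : ℝ)) (B := t) (M := lam)
    (δ := μ * lam / 2) ht0.le (by positivity) (fun i => ⟨by positivity, hk't i⟩)
    (by simpa using (Finset.sum_le_sum fun i _ => hk'k i).trans hk)
  have hB2 := card_filter_powersetCard_sum_gt_le l hl0 a (B := 1) (M := α + ε / 4)
    (δ := ε / 4) zero_le_one (by positivity) (fun i => ⟨by positivity, ha1 _ i⟩)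
    (by simpa using hasum)
  rw [Fintype.card_fin] at hB1 hB2
  set b1 := (Finset.univ.powersetCard l).filter
    (fun s : Finset (Fin m) => (lam + μ * lam / 2) * l < ∑ i ∈ s, (k' i : ℝ))
  set b2 := (Finset.univ.powersetCard l).filter
    (fun s : Finset (Fin m) => (α + ε / 4 + ε / 4) * l < ∑ i ∈ s, a i)
  set good := ((Finset.univ : Finset (Fin m)).powersetCard l).filter
    (fun s => ∃ g ∈ compClassT C t ((1 + μ / 2) * lam * l),
      distD (D[|{x : Σ i, X i | x.1 ∈ s}]) f g ≤ α + ε / 2) with hgood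
  have hcover : (Finset.univ : Finset (Fin m)).powersetCard l ⊆ good ∪ (b1 ∪ b2) := by
    intro s hs
    by_contra hns
    simp only [Finset.mem_union, not_or, hgood, b1, b2, Finset.mem_filter, hs, true_and,
      not_lt] at hns
    obtain ⟨hn, h1, h2⟩ := hns
    rw [Finset.mem_powersetCard_univ] at hs
    have hpC : ∀ i, (fun x : X i => if i ∈ s then h ⟨i, x⟩ else z i x) ∈
        C i (if i ∈ s then k' i else 0) := by
      intro i
      by_cases hi : i ∈ s
      · simpa [hi] using hhC i
      · simpa [hi] using hz i
    refine hn ⟨fun x => if x.1 ∈ s then h x else z x.1 x.2,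
      ⟨measurable_sigma_of_comp_mk fun i => hCm i _ _ (hpC i),
        fun i => if i ∈ s then k' i else 0, ?_, ?_, hpC⟩, ?_⟩
    · have : ∑ i, ((if i ∈ s then k' i else 0 : ℕ) : ℝ) = ∑ i ∈ s, (k' i : ℝ) := by
        simp only [Nat.cast_ite, Nat.cast_zero, Finset.sum_ite_mem, Finset.univ_inter]
      linarith
    · intro i
      by_cases hi : i ∈ s
      · simpa [hi] using hk't i
      · simpa [hi] using ht0.le
    · have hsum : ∑ i ∈ s, m * D.real ({x | x.1 = i} ∩
          {x | f x ≠ if x.1 ∈ s then h x else z x.1 x.2}) = ∑ i ∈ s, a i := by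
        refine Finset.sum_congr rfl fun i hi => ?_
        congr 2
        ext ⟨j, x⟩
        simp only [Set.mem_inter_iff, Set.mem_ofPred_eq, and_congr_right_iff]
        rintro rfl
        simp [hi]
      rw [distD_cond_eq D hD, hsum, hs, div_le_iff₀ hlR]
      linarith
  have hN : (((Finset.univ : Finset (Fin m)).powersetCard l).card : ℝ) = m.choose l := by
    simp
  have hcard : (m.choose l : ℝ) ≤ good.card + (b1.card + b2.card) := by
    rw [← hN]
    exact_mod_cast (Finset.card_le_card hcover).trans ((Finset.card_union_le _ _).trans
      (Nat.add_le_add_left (Finset.card_union_le _ _) _))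
  have hlow1 : 400 ≤ ε * μ ^ 2 * l := by
    have : 400 * (1 / (ε * μ ^ 2)) ≤ l := by
      have : 0 < 1 / ε ^ 2 := by positivity
      linarith
    rwa [mul_one_div, div_le_iff₀ (by positivity), mul_comm] at this
  have hlow2 : 400 ≤ ε ^ 2 * l := by
    have : 400 * (1 / ε ^ 2) ≤ l := by
      have : 0 < 1 / (ε * μ ^ 2) := by positivity
      linarith
    rwa [mul_one_div, div_le_iff₀ (by positivity), mul_comm] at this
  have hc1 : (b1.card : ℝ) * 25 ≤ m.choose l := by
    have h1 : (b1.card : ℝ) * (ε * μ ^ 2 * l) ≤ 16 * m.choose l := by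
      have e1 : (b1.card : ℝ) * ((μ * lam / 2) ^ 2 * l) =
          lam ^ 2 / (4 * ε) * (b1.card * (ε * μ ^ 2 * l)) := by
        ring_nf
        field_simp
      have e2 : t * lam * m.choose l = lam ^ 2 / (4 * ε) * (16 * m.choose l) := by
        rw [ht]
        ring
      rw [e1, e2] at hB1
      exact le_of_mul_le_mul_left hB1 (by positivity)
    have h2 := mul_le_mul_of_nonneg_left hlow1 (Nat.cast_nonneg (α := ℝ) b1.card)
    linarith
  have hc2 : (b2.card : ℝ) * 20 ≤ m.choose l := by
    have h1 : 1 * (α + ε / 4) * m.choose l ≤ 5 / 4 * m.choose l := by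
      have := hα.2
      gcongr
      linarith
    have h2 := mul_le_mul_of_nonneg_left hlow2 (Nat.cast_nonneg (α := ℝ) b2.card)
    have e : (b2.card : ℝ) * ((ε / 4) ^ 2 * l) = b2.card * (ε ^ 2 * l) / 16 := by ring
    linarith
  rw [hN]
  have : (0 : ℝ) ≤ m.choose l := by positivity
  linarith
end

section
/- There exists an absolute constant C > 0 such that the following holds. Let m ≥ 1, let D be a semi-uniform probability measure on the disjoint union X of measurable spaces X_1,…,X_m with composition classes P and P^t as in the composition setup, let λ > 0, let ε, μ ∈ (0,1), let α ∈ [0,1], and set t = 4λ/ε. Let l be an integer with C·(1/(ε·μ²) + 1/ε²) ≤ l ≤ m, let I be a uniformly random size-l subset of {1,…,m}, and let D_I denote D conditioned on the event that the point lies in ∪_{i∈I} X_i. If f is measurable and f ∉ P_D((1+μ)·λ·m, α), then with probability at least 5/6 over the choice of I, every g ∈ P^t((1+μ/2)·λ·l) satisfies dist_{D_I}(f,g) > α − ε/2. -/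
open MeasureTheory ProbabilityTheory
open scoped Classical

/-- Lagrangian duality for a separable knapsack problem: up to an additive loss of `1`, the
optimal value is certified by a single price `p` and lower bounds `h i` on the priced costs. -/
theorem exists_price_of_knapsack {ι : Type*} [Fintype ι] (K : ι → Finset ℕ)
    (hK : ∀ i, 0 ∈ K i) (e : ι → ℕ → ℝ) (he0 : ∀ i k, 0 ≤ e i k) (he1 : ∀ i k, e i k ≤ 1)
    {B V : ℝ} (hB : 0 ≤ B)
    (hV : ∀ k : ι → ℕ, (∀ i, k i ∈ K i) → ∑ i, (k i : ℝ) ≤ B → V ≤ ∑ i, e i (k i)) :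
    ∃ p : ℝ, 0 ≤ p ∧ ∃ h : ι → ℝ, (∀ i, 0 ≤ h i ∧ h i ≤ 1) ∧
      (∀ i, ∀ k ∈ K i, h i ≤ e i k + p * k) ∧ V - 1 + p * B ≤ ∑ i, h i := by
  -- It suffices to find a coordinatewise optimal `c` whose priced excess is large.
  suffices ∃ p : ℝ, 0 ≤ p ∧ ∃ c : ι → ℕ, (∀ i, c i ∈ K i) ∧
      (∀ i, ∀ k ∈ K i, e i (c i) + p * c i ≤ e i k + p * k) ∧
      V - 1 + p * B ≤ ∑ i, (e i (c i) + p * c i) by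
    obtain ⟨p, hp, c, -, hopt, hval⟩ := this
    refine ⟨p, hp, fun i => e i (c i) + p * c i, fun i => ⟨?_, ?_⟩, hopt, hval⟩
    · have := he0 i (c i); positivity
    · have := hopt i 0 (hK i)
      have := he1 i 0
      simp only [Nat.cast_zero, mul_zero, add_zero] at *
      linarith
  let O : (ι → ℕ) → Set ℝ := fun c =>
    {p | ∀ i, ∀ k ∈ K i, e i (c i) + p * c i ≤ e i k + p * k}
  have hO : ∀ c, IsClosed (O c) := fun c => by
    simp only [O, Set.ofPred_forall]
    refine isClosed_iInter fun i => isClosed_iInter fun k => isClosed_iInter fun _ =>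
      isClosed_le (by fun_prop) (by fun_prop)
  let F := Fintype.piFinset K
  let low := ⋃ c ∈ F.filter (fun c => ∑ i, (c i : ℝ) ≤ B), O c
  let high := ⋃ c ∈ F.filter (fun c => B ≤ ∑ i, (c i : ℝ)), O c
  have hlow : IsClosed low := Set.Finite.isClosed_biUnion (Finset.finite_toSet _) fun c _ => hO c
  have hhigh : IsClosed high := Set.Finite.isClosed_biUnion (Finset.finite_toSet _) fun c _ => hO c
  have memlow : ∀ p, p ∈ low ↔ ∃ c : ι → ℕ, (∀ i, c i ∈ K i) ∧ ∑ i, (c i : ℝ) ≤ B ∧ p ∈ O c := by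
    intro p; simp [low, F, and_assoc]
  have memhigh : ∀ p, p ∈ high ↔
      ∃ c : ι → ℕ, (∀ i, c i ∈ K i) ∧ B ≤ ∑ i, (c i : ℝ) ∧ p ∈ O c := by
    intro p; simp [high, F, and_assoc]
  have hcover : ∀ p, p ∈ low ∨ p ∈ high := by
    intro p
    choose c hc hmin using fun i =>
      Finset.exists_min_image (K i) (fun k : ℕ => e i k + p * k) ⟨0, hK i⟩
    rcases le_total (∑ i, (c i : ℝ)) B with h | h
    · exact Or.inl ((memlow p).2 ⟨c, hc, h, hmin⟩)
    · exact Or.inr ((memhigh p).2 ⟨c, hc, h, hmin⟩)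
  by_cases h0 : (0 : ℝ) ∈ low
  · obtain ⟨c, hc, hcB, hopt⟩ := (memlow 0).1 h0
    refine ⟨0, le_rfl, c, hc, hopt, ?_⟩
    have := hV c hc hcB
    simp only [zero_mul, add_zero]
    linarith
  have h1 : (1 : ℝ) ∈ low := by
    refine (memlow 1).2 ⟨fun _ => 0, hK, by simpa using hB, fun i k _ => ?_⟩
    rcases Nat.eq_zero_or_pos k with rfl | hk
    · simp
    · have : (1 : ℝ) ≤ k := by exact_mod_cast hk
      have := he0 i k
      have := he1 i 0
      simp only [Nat.cast_zero, mul_zero, add_zero]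
      linarith
  obtain ⟨p, ⟨hp, -⟩, hpl, hph⟩ := isPreconnected_closed_iff.1
    (isPreconnected_Icc (a := (0 : ℝ)) (b := 1)) low high hlow hhigh (fun p _ => hcover p)
    ⟨1, by simp, h1⟩ ⟨0, by simp, (hcover 0).resolve_left h0⟩
  obtain ⟨a, haK, haB, haO⟩ := (memlow p).1 hpl
  obtain ⟨b, hbK, hbB, hbO⟩ := (memhigh p).1 hph
  -- Switch from `a` to `b` one coordinate at a time until the budget is exceeded.
  let mix : Finset ι → ι → ℕ := fun T i => if i ∈ T then b i else a i
  have hmixK : ∀ T i, mix T i ∈ K i := fun T i => by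
    simp only [mix]; split_ifs; exacts [hbK i, haK i]
  have hmixO : ∀ T, p ∈ O (mix T) := fun T i k hk => by
    simp only [mix]; split_ifs; exacts [hbO i k hk, haO i k hk]
  obtain ⟨T, hT, hTmax⟩ := Finset.exists_max_image
    (Finset.univ.filter fun T => ∑ i, (mix T i : ℝ) ≤ B) Finset.card
    ⟨∅, by simpa [mix] using haB⟩
  have hTB : ∑ i, (mix T i : ℝ) ≤ B := by simpa using hT
  have hTV := hV _ (hmixK T) hTB
  by_cases hTu : T = Finset.univ
  · refine ⟨p, hp, mix T, hmixK T, hmixO T, ?_⟩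
    have : B ≤ ∑ i, (mix T i : ℝ) := by simpa [mix, hTu] using hbB
    have := mul_le_mul_of_nonneg_left this hp
    rw [Finset.sum_add_distrib, ← Finset.mul_sum]
    linarith
  obtain ⟨j, hj⟩ : ∃ j, j ∉ T := by
    by_contra! h
    exact hTu (Finset.eq_univ_iff_forall.2 h)
  refine ⟨p, hp, mix (insert j T), hmixK _, hmixO _, ?_⟩
  have hBj : B ≤ ∑ i, (mix (insert j T) i : ℝ) := by
    by_contra! h
    have := hTmax (insert j T) (by simpa using h.le)
    rw [Finset.card_insert_of_notMem hj] at this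
    omega
  have hdiff : ∑ i, e i (mix T i) - 1 ≤ ∑ i, e i (mix (insert j T) i) := by
    rw [← Finset.add_sum_erase _ _ (Finset.mem_univ j),
      ← Finset.add_sum_erase _ (fun i => e i (mix (insert j T) i)) (Finset.mem_univ j)]
    have : ∑ i ∈ Finset.univ.erase j, e i (mix (insert j T) i) =
        ∑ i ∈ Finset.univ.erase j, e i (mix T i) :=
      Finset.sum_congr rfl fun i hi => by simp [mix, Finset.ne_of_mem_erase hi]
    have := he1 j (mix T j)
    have := he0 j (mix (insert j T) j)
    linarith
  have := mul_le_mul_of_nonneg_left hBj hp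
  rw [Finset.sum_add_distrib, ← Finset.mul_sum]
  linarith

/-- Second moment of a sum over a uniformly random `l`-subset, for centred summands. -/
theorem sum_powersetCard_sq_le_s2 {ι : Type*} [Fintype ι] {l : ℕ}
    (x : ι → ℝ) (hx : ∑ i, x i = 0) (hx1 : ∀ i, |x i| ≤ 1) :
    ∑ s ∈ (Finset.univ : Finset ι).powersetCard l, (∑ i ∈ s, x i) ^ 2 ≤
      l * ((Finset.univ : Finset ι).powersetCard l).card := by
  set P := (Finset.univ : Finset ι).powersetCard l with hP
  -- The number of `l`-subsets containing two given distinct points is a constant `N`.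
  obtain ⟨N, hN⟩ : ∃ N : ℕ, ∀ i j : ι, i ≠ j → (P.filter fun s => i ∈ s ∧ j ∈ s).card = N := by
    by_cases h2 : 2 ≤ l
    · refine ⟨(Fintype.card ι - 2).choose (l - 2), fun i j hij => ?_⟩
      have := Finset.card_filter_powersetCard_subset ({i, j} : Finset ι) Finset.univ l
        (Finset.subset_univ _) (by rwa [Finset.card_pair hij])
      simpa [Finset.card_pair hij, Finset.insert_subset_iff, hP] using this
    · refine ⟨0, fun i j hij => ?_⟩
      rw [Finset.card_eq_zero, Finset.filter_eq_empty_iff]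
      rintro s hs ⟨hi, hj⟩
      have := Finset.one_lt_card.2 ⟨i, hi, j, hj, hij⟩
      have := (Finset.mem_powersetCard.1 hs).2
      omega
  have hsum : ∀ s : Finset ι, ∑ i ∈ s, x i = ∑ i, if i ∈ s then x i else 0 := fun s => by simp
  have key : ∑ s ∈ P, (∑ i ∈ s, x i) ^ 2 =
      ∑ i, ∑ j, x i * x j * ((P.filter fun s => i ∈ s ∧ j ∈ s).card : ℝ) := by
    simp only [hsum, sq, Finset.sum_mul_sum]
    rw [Finset.sum_comm]
    refine Finset.sum_congr rfl fun i _ => ?_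
    rw [Finset.sum_comm]
    refine Finset.sum_congr rfl fun j _ => ?_
    rw [Finset.card_filter, Nat.cast_sum, Finset.mul_sum]
    refine Finset.sum_congr rfl fun s _ => ?_
    by_cases hi : i ∈ s <;> by_cases hj : j ∈ s <;> simp [hi, hj]
  have hdiag : ∀ i, ∑ j, x i * x j * ((P.filter fun s => i ∈ s ∧ j ∈ s).card : ℝ) ≤
      x i * N * ∑ j, x j + ((P.filter fun s => i ∈ s).card : ℝ) := by
    intro i
    rw [← Finset.add_sum_erase _ _ (Finset.mem_univ i),
      ← Finset.add_sum_erase _ x (Finset.mem_univ i)]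
    have h1 : ∑ j ∈ Finset.univ.erase i, x i * x j * ((P.filter fun s => i ∈ s ∧ j ∈ s).card : ℝ) =
        x i * N * ∑ j ∈ Finset.univ.erase i, x j := by
      rw [Finset.mul_sum]
      refine Finset.sum_congr rfl fun j hj => ?_
      rw [hN i j (Finset.ne_of_mem_erase hj).symm]
      ring
    rw [h1]
    simp only [and_self]
    have h2 : x i * x i ≤ 1 := by
      have := abs_le.1 (hx1 i); nlinarith
    have h3 : x i * x i * ((P.filter fun s => i ∈ s).card : ℝ) ≤ (P.filter fun s => i ∈ s).card :=
      mul_le_of_le_one_left (by positivity) h2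
    have h4 : 0 ≤ x i * x i * (N : ℝ) := mul_nonneg (mul_self_nonneg _) (by positivity)
    linarith
  rw [key]
  refine (Finset.sum_le_sum fun i _ => hdiag i).trans ?_
  simp only [hx, mul_zero, zero_add]
  have : ∑ i, (P.filter fun s => i ∈ s).card = ∑ s ∈ P, s.card := by
    simp only [Finset.card_filter]
    rw [Finset.sum_comm]
    simp
  rw [← Nat.cast_sum, this, Finset.sum_congr rfl fun s hs => (Finset.mem_powersetCard.1 hs).2]
  rw [Finset.sum_const, smul_eq_mul, Nat.cast_mul, mul_comm]

/-- Chebyshev's lower-tail inequality for sampling without replacement. -/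
theorem card_powersetCard_lower_tail {ι : Type*} [Fintype ι] {l : ℕ}
    (h : ι → ℝ) (h01 : ∀ i, 0 ≤ h i ∧ h i ≤ 1) {a δ : ℝ} (hδ : 0 < δ)
    (ha : a * Fintype.card ι = ∑ i, h i) (ha0 : 0 ≤ a) (ha1 : a ≤ 1) :
    l * δ ^ 2 * ((((Finset.univ : Finset ι).powersetCard l).filter
      fun s => ∑ i ∈ s, h i ≤ l * (a - δ)).card : ℝ) ≤
        ((Finset.univ : Finset ι).powersetCard l).card := by
  rcases Nat.eq_zero_or_pos l with rfl | hl0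
  · simp
  have hl0' : (0 : ℝ) < l := by exact_mod_cast hl0
  have hsq := sum_powersetCard_sq_le_s2 (l := l) (fun i => h i - a)
    (by simp [Finset.sum_sub_distrib, ← ha, mul_comm])
    (fun i => abs_le.2 ⟨by linarith [(h01 i).1], by linarith [(h01 i).2]⟩)
  set P := (Finset.univ : Finset ι).powersetCard l with hP
  set Q := P.filter fun s => ∑ i ∈ s, h i ≤ l * (a - δ) with hQ
  have hmarkov : (Q.card : ℝ) * (l * δ) ^ 2 ≤ l * P.card := by
    refine le_trans ?_ hsq
    refine le_trans ?_ (Finset.sum_le_sum_of_subset_of_nonneg (show Q ⊆ P from Finset.filter_subset _ _)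
      fun s _ _ => sq_nonneg _)
    rw [← nsmul_eq_mul]
    refine Finset.card_nsmul_le_sum _ _ _ fun s hs => ?_
    obtain ⟨hsP, hs⟩ := Finset.mem_filter.1 hs
    have hc : (s.card : ℝ) = l := by exact_mod_cast (Finset.mem_powersetCard.1 hsP).2
    rw [Finset.sum_sub_distrib, Finset.sum_const, nsmul_eq_mul, hc, ← neg_sq (_ - _)]
    have : 0 < (l : ℝ) * δ := by positivity
    gcongr
    linarith
  refine le_of_mul_le_mul_left ?_ hl0'
  linarith

section SigmaPieces

variable {m : ℕ} {X : Fin m → Type*} [∀ i, MeasurableSpace (X i)]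

/-- `m` times the mass of the part of piece `i` on which `f` and `g` disagree; under
semi-uniformity this is the distance conditioned on that piece. -/
noncomputable def pieceDist (D : Measure (Σ i, X i)) (f : (Σ i, X i) → Bool) (i : Fin m)
    (g : X i → Bool) : ℝ :=
  m * D.real (Sigma.mk i '' {y | f ⟨i, y⟩ ≠ g y})

theorem pieceDist_nonneg (D : Measure (Σ i, X i)) (f : (Σ i, X i) → Bool) (i : Fin m)
    (g : X i → Bool) : 0 ≤ pieceDist D f i g := by
  unfold pieceDist; positivity

theorem pieceDist_le_one {D : Measure (Σ i, X i)} [IsProbabilityMeasure D]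
    (hD : ∀ i : Fin m, D {x : Σ i, X i | x.1 = i} = 1 / m) (f : (Σ i, X i) → Bool) (i : Fin m)
    (g : X i → Bool) : pieceDist D f i g ≤ 1 := by
  have hm : (0 : ℝ) < m := by exact_mod_cast i.pos
  have h1 : D.real (Sigma.mk i '' {y | f ⟨i, y⟩ ≠ g y}) ≤ D.real {x : Σ i, X i | x.1 = i} :=
    measureReal_mono (by rintro _ ⟨y, -, rfl⟩; rfl)
  have h2 : D.real {x : Σ i, X i | x.1 = i} = 1 / m := by simp [Measure.real, hD]
  rw [h2] at h1
  calc pieceDist D f i g ≤ m * (1 / m) := mul_le_mul_of_nonneg_left h1 hm.le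
    _ = 1 := by field_simp

theorem measurableSet_sigma_iff_forall {A : Set (Σ i, X i)} :
    MeasurableSet A ↔ ∀ i, MeasurableSet (Sigma.mk i ⁻¹' A) := by
  rw [show MeasurableSet A ↔ MeasurableSet[⨅ i, MeasurableSpace.map (Sigma.mk i) _] A from Iff.rfl,
    MeasurableSpace.measurableSet_iInf]
  rfl

theorem measurable_sigma_iff_forall {f : (Σ i, X i) → Bool} :
    Measurable f ↔ ∀ i, Measurable fun y => f ⟨i, y⟩ :=
  ⟨fun hf i _ hs => measurableSet_sigma_iff_forall.1 (hf hs) i,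
    fun hf _ hs => measurableSet_sigma_iff_forall.2 fun i => hf i hs⟩

theorem measurableSet_fst_mem (s : Set (Fin m)) :
    MeasurableSet {x : Σ i, X i | x.1 ∈ s} :=
  measurableSet_sigma_iff_forall.2 fun i => MeasurableSet.const (i ∈ s)

theorem measureReal_disagree_eq_sum (D : Measure (Σ i, X i)) [IsProbabilityMeasure D]
    {f g : (Σ i, X i) → Bool} (hf : Measurable f) (hg : Measurable g) (s : Finset (Fin m)) :
    m * D.real ({x | x.1 ∈ s} ∩ {x | f x ≠ g x}) =
      ∑ i ∈ s, pieceDist D f i fun y => g ⟨i, y⟩ := by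
  have hU : {x : Σ i, X i | x.1 ∈ s} ∩ {x | f x ≠ g x} =
      ⋃ i ∈ s, Sigma.mk i '' {y | f ⟨i, y⟩ ≠ g ⟨i, y⟩} := by
    ext ⟨i, y⟩
    simp only [Set.mem_inter_iff, Set.mem_ofPred_eq, Set.mem_iUnion, Set.mem_image]
    constructor
    · rintro ⟨hi, hy⟩
      exact ⟨i, hi, y, hy, rfl⟩
    · rintro ⟨j, hj, z, hz, h⟩
      cases h
      exact ⟨hj, hz⟩
  have hmeas : MeasurableSet {x | f x ≠ g x} := (measurableSet_eq_fun hf hg).compl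
  rw [hU, measureReal_biUnion_finset]
  · simp only [pieceDist, Finset.mul_sum]
  · intro i _ j _ hij
    refine Set.disjoint_left.2 ?_
    rintro _ ⟨y, -, rfl⟩ ⟨z, -, h⟩
    exact hij (congrArg Sigma.fst h).symm
  · intro i _
    have : Sigma.mk i '' {y | f ⟨i, y⟩ ≠ g ⟨i, y⟩} =
        {x : Σ i, X i | x.1 ∈ ({i} : Set (Fin m))} ∩ {x | f x ≠ g x} := by
      ext ⟨j, y⟩
      simp only [Set.mem_inter_iff, Set.mem_ofPred_eq, Set.mem_image, Set.mem_singleton_iff]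
      constructor
      · rintro ⟨z, hz, h⟩
        cases h
        exact ⟨rfl, hz⟩
      · rintro ⟨rfl, hy⟩
        exact ⟨y, hy, rfl⟩
    rw [this]
    exact (measurableSet_fst_mem _).inter hmeas

theorem mul_distD_eq_sum (D : Measure (Σ i, X i)) [IsProbabilityMeasure D]
    {f g : (Σ i, X i) → Bool} (hf : Measurable f) (hg : Measurable g) :
    m * distD D f g = ∑ i, pieceDist D f i fun y => g ⟨i, y⟩ := by
  rw [← measureReal_disagree_eq_sum D hf hg]
  simp [distD, Measure.real]

theorem card_mul_distD_cond_eq_sum {D : Measure (Σ i, X i)} [IsProbabilityMeasure D]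
    (hD : ∀ i : Fin m, D {x : Σ i, X i | x.1 = i} = 1 / m)
    {f g : (Σ i, X i) → Bool} (hf : Measurable f) (hg : Measurable g) {s : Finset (Fin m)}
    (hs : s.Nonempty) :
    s.card * distD (D[|{x : Σ i, X i | x.1 ∈ s}]) f g =
      ∑ i ∈ s, pieceDist D f i fun y => g ⟨i, y⟩ := by
  have hm : (0 : ℝ) < m := by exact_mod_cast hs.choose.pos
  have hs0 : (0 : ℝ) < s.card := by exact_mod_cast hs.card_pos
  have hset : {x : Σ i, X i | x.1 ∈ s} = ⋃ i ∈ s, {x : Σ i, X i | x.1 = i} := by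
    ext x; simp
  have hmass : D.real {x : Σ i, X i | x.1 ∈ s} = s.card / m := by
    rw [hset, measureReal_biUnion_finset]
    · simp [Measure.real, hD, div_eq_mul_inv]
    · intro i _ j _ hij
      exact Set.disjoint_left.2 fun x hx hx' => hij (hx.symm.trans hx')
    · intro i _
      exact measurableSet_fst_mem {i}
  have hS : MeasurableSet {x : Σ i, X i | x.1 ∈ s} := measurableSet_fst_mem (s : Set (Fin m))
  rw [← measureReal_disagree_eq_sum D hf hg, distD, cond_apply hS, ENNReal.toReal_mul,
    ENNReal.toReal_inv, ← measureReal_def, ← measureReal_def, hmass]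
  field_simp

end SigmaPieces

/-- Lemma 4.2 of the paper: if `f ∉ P_D((1+μ)λm, α)` then, with probability at least `5/6` over
a uniformly random size-`l` subset `I` of the `m` pieces, every `g ∈ P^t((1+μ/2)λl)` satisfies
`dist_{D_I}(f,g) > α − ε/2`, where `t = 4λ/ε` and `D_I` is `D` conditioned on `∪_{i ∈ I} X_i`. -/
theorem composition_notin :
    ∃ c : ℝ, 0 < c ∧
      ∀ (m : ℕ) (X : Fin m → Type) [∀ i, MeasurableSpace (X i)]
        (D : Measure (Σ i, X i)) [IsProbabilityMeasure D],
        (∀ i : Fin m, D {x : Σ i, X i | x.1 = i} = 1 / m) →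
        ∀ (C : (i : Fin m) → ℕ → Set (X i → Bool)),
          (∀ i, (C i 0).Nonempty) →
          (∀ i k, ∀ g ∈ C i k, Measurable g) →
          ∀ (lam ε μ α : ℝ), 0 < lam → ε ∈ Set.Ioo (0 : ℝ) 1 → μ ∈ Set.Ioo (0 : ℝ) 1 →
            α ∈ Set.Icc (0 : ℝ) 1 →
          ∀ (l : ℕ), c * (1 / (ε * μ ^ 2) + 1 / ε ^ 2) ≤ l → l ≤ m →
          ∀ (f : (Σ i, X i) → Bool), Measurable f →
            f ∉ compClose C D ((1 + μ) * lam * m) α →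
            (5 : ℝ) / 6 * ((Finset.univ : Finset (Fin m)).powersetCard l).card ≤
              (((Finset.univ : Finset (Fin m)).powersetCard l).filter
                (fun s => ∀ g ∈ compClassT C (4 * lam / ε) ((1 + μ / 2) * lam * l),
                  α - ε / 2 < distD (D[|{x : Σ i, X i | x.1 ∈ s}]) f g)).card := by
  refine ⟨96, by norm_num, ?_⟩
  intro m X _ D _ hD C hC0 hCmeas lam ε μ α hlam ⟨hε0, hε1⟩ ⟨hμ0, hμ1⟩ ⟨hα0, hα1⟩ l hl hlm f hf hfar
  have hlε : 96 ≤ l * ε ^ 2 := by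
    have h1 : 0 < 1 / (ε * μ ^ 2) := by positivity
    have h2 : 96 * (1 / ε ^ 2) ≤ l := by linarith
    rw [mul_one_div, div_le_iff₀ (by positivity)] at h2
    exact h2
  have hl0 : (0 : ℝ) < l := by
    by_contra! h
    nlinarith [sq_nonneg ε]
  have hlm' : (l : ℝ) ≤ m := by exact_mod_cast hlm
  have hm0 : (0 : ℝ) < m := hl0.trans_le hlm'
  have hmε : 4 ≤ m * ε := by nlinarith [mul_pos hl0 hε0]
  have hBpos : 0 ≤ (1 + μ) * lam := by positivity
  -- The best distance to `C i k` on the `i`-th piece.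
  let e : Fin m → ℕ → ℝ := fun i k => ⨅ g : C i k, pieceDist D f i g
  have hbdd : ∀ i k, BddBelow (Set.range fun g : C i k => pieceDist D f i g) := fun i k =>
    ⟨0, by rintro _ ⟨g, rfl⟩; exact pieceDist_nonneg D f i g⟩
  have he0 : ∀ i k, 0 ≤ e i k := fun i k => Real.iInf_nonneg fun g => pieceDist_nonneg D f i g
  have he1 : ∀ i k, e i k ≤ 1 := fun i k => by
    rcases isEmpty_or_nonempty (C i k) with h | ⟨⟨g⟩⟩
    · simp [e, Real.iInf_of_isEmpty]
    · exact (ciInf_le (hbdd i k) g).trans (pieceDist_le_one hD f i g)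
  let K : Fin m → Finset ℕ := fun i =>
    (Finset.range (⌊4 * lam / ε⌋₊ + 1)).filter fun k => (C i k).Nonempty
  have hK : ∀ i, 0 ∈ K i := fun i => by simp [K, hC0 i]
  have hV : ∀ k : Fin m → ℕ, (∀ i, k i ∈ K i) → ∑ i, (k i : ℝ) ≤ (1 + μ) * lam * m →
      α * m ≤ ∑ i, e i (k i) := by
    intro k hk hkB
    refine le_of_forall_pos_le_add fun η hη => ?_
    have hex : ∀ i, ∃ g : C i (k i), pieceDist D f i g < e i (k i) + η / m := fun i => by
      have : Nonempty (C i (k i)) := (Finset.mem_filter.1 (hk i)).2.to_subtype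
      exact exists_lt_of_ciInf_lt (lt_add_of_pos_right _ (by positivity))
    choose g hg using hex
    have hgm : Measurable fun x : Σ i, X i => (g x.1 : X x.1 → Bool) x.2 :=
      measurable_sigma_iff_forall.2 fun i => hCmeas i _ _ (g i).2
    have hdist : α < distD D f fun x : Σ i, X i => (g x.1 : X x.1 → Bool) x.2 := by
      by_contra! h
      exact hfar ⟨hf, _, ⟨hgm, k, hkB, fun i => (g i).2⟩, h⟩
    have hsum := mul_distD_eq_sum D hf hgm
    have hle : ∑ i, pieceDist D f i (g i) ≤ ∑ i, (e i (k i) + η / m) :=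
      Finset.sum_le_sum fun i _ => (hg i).le
    rw [Finset.sum_add_distrib, Finset.sum_const, Finset.card_univ, Fintype.card_fin, nsmul_eq_mul,
      mul_div_cancel₀ _ hm0.ne'] at hle
    nlinarith [mul_lt_mul_of_pos_left hdist hm0]
  obtain ⟨p, hp, h, h01, hle, hval⟩ := exists_price_of_knapsack K hK e he0 he1
    (mul_nonneg hBpos hm0.le) hV
  set a := (∑ i, h i) / m with ha
  have ham : a * m = ∑ i, h i := div_mul_cancel₀ _ hm0.ne'
  have ha0 : 0 ≤ a := div_nonneg (Finset.sum_nonneg fun i _ => (h01 i).1) hm0.le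
  have ha1 : a ≤ 1 := by
    rw [ha, div_le_one hm0]
    simpa using Finset.sum_le_sum fun i (_ : i ∈ Finset.univ) => (h01 i).2
  have hlow : α - ε / 4 + p * ((1 + μ) * lam) ≤ a := by
    refine le_of_mul_le_mul_right ?_ hm0
    rw [ham]
    linarith
  have htail := card_powersetCard_lower_tail (l := l) h h01 (δ := ε / 4) (by positivity)
    (by simpa using ham) ha0 ha1
  set P := (Finset.univ : Finset (Fin m)).powersetCard l
  have hsplit := Finset.card_filter_add_card_filter_not (s := P)
    (fun s => ∑ i ∈ s, h i ≤ l * (a - ε / 4))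
  have hgood : (P.filter fun s => ¬ ∑ i ∈ s, h i ≤ l * (a - ε / 4)) ⊆ P.filter fun s =>
      ∀ g ∈ compClassT C (4 * lam / ε) ((1 + μ / 2) * lam * l),
        α - ε / 2 < distD (D[|{x : Σ i, X i | x.1 ∈ s}]) f g := by
    intro s hs
    obtain ⟨hsP, hs⟩ := Finset.mem_filter.1 hs
    refine Finset.mem_filter.2 ⟨hsP, ?_⟩
    rintro g ⟨hgm, k, hksum, hkt, hgC⟩
    push Not at hs
    have hcard : s.card = l := (Finset.mem_powersetCard.1 hsP).2
    have hne : s.Nonempty := Finset.card_pos.1 (by rw [hcard]; exact_mod_cast hl0)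
    have hdist := card_mul_distD_cond_eq_sum hD hf hgm hne
    rw [hcard] at hdist
    have hkK : ∀ i, k i ∈ K i := fun i => Finset.mem_filter.2
      ⟨Finset.mem_range.2 (Nat.lt_succ_of_le (Nat.le_floor (hkt i))), _, hgC i⟩
    have hpiece : ∑ i ∈ s, h i ≤ ∑ i ∈ s, (pieceDist D f i (fun y => g ⟨i, y⟩) + p * k i) := by
      refine Finset.sum_le_sum fun i _ => (hle i (k i) (hkK i)).trans ?_
      have : e i (k i) ≤ pieceDist D f i fun y => g ⟨i, y⟩ :=
        ciInf_le (hbdd i (k i)) ⟨_, hgC i⟩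
      linarith
    rw [Finset.sum_add_distrib, ← Finset.mul_sum, ← hdist] at hpiece
    have hks : ∑ i ∈ s, (k i : ℝ) ≤ (1 + μ) * lam * l := by
      refine (Finset.sum_le_sum_of_subset_of_nonneg (Finset.subset_univ s)
        fun i _ _ => Nat.cast_nonneg _).trans (hksum.trans ?_)
      gcongr
      linarith
    have hpk := mul_le_mul_of_nonneg_left hks hp
    have hal := mul_le_mul_of_nonneg_left hlow hl0.le
    refine lt_of_mul_lt_mul_left ?_ hl0.le
    linarith
  have hgood' := Finset.card_le_card hgood
  have hsplit' : ((P.filter fun s => ∑ i ∈ s, h i ≤ l * (a - ε / 4)).card : ℝ) +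
      (P.filter fun s => ¬ ∑ i ∈ s, h i ≤ l * (a - ε / 4)).card = P.card := by
    exact_mod_cast hsplit
  have hbad : 6 * ((P.filter fun s => ∑ i ∈ s, h i ≤ l * (a - ε / 4)).card : ℝ) ≤ P.card := by
    refine le_trans ?_ htail
    gcongr
    linarith
  have hgood'' : ((P.filter fun s => ¬ ∑ i ∈ s, h i ≤ l * (a - ε / 4)).card : ℝ) ≤
      (P.filter fun s => ∀ g ∈ compClassT C (4 * lam / ε) ((1 + μ / 2) * lam * l),
        α - ε / 2 < distD (D[|{x : Σ i, X i | x.1 ∈ s}]) f g).card := by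
    exact_mod_cast hgood'
  linarith
end
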